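/- arXiv:0909.3100 — 2 statements merged into one kernel-verified Lean document; each statement's English description precedes it below -/
import Mathlib

section
/- Let F be a field of characteristic 0. The Beltrami algebra, namely the formal power series ring F[[x]] equipped with the commutative bilinear product f ∘ g = (f·g)' (the formal derivative of the ordinary product f·g), is a simple algebra: its only ideals are 0 and F[[x]]. -/
namespace PowerSeries

theorem derivative_surjective (F : Type*) [Field F] [CharZero F] :
    Function.Surjective (derivative F) := fun w => by
  refine ⟨mk fun n => coeff (n - 1) w / n, ?_⟩
  ext n
  have h : (n : F) + 1 ≠ 0 := Nat.cast_add_one_ne_zero n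
  rw [coeff_derivative, coeff_mk]
  push_cast
  simp [h]

theorem derivative_X_pow_succ (F : Type*) [Field F] (n : ℕ) :
    derivative F (X ^ (n + 1) : PowerSeries F) = ((n : F) + 1) • X ^ n := by
  ext k
  rw [coeff_derivative, coeff_smul, coeff_X_pow, coeff_X_pow]
  by_cases h : k = n <;> simp [h]

/-- A subspace closed under the Beltrami product that contains a power of `X` is everything. -/
theorem eq_top_of_X_pow_mem {F : Type*} [Field F] [CharZero F] {I : Submodule F (PowerSeries F)}
    (hI : ∀ u ∈ I, ∀ v, derivative F (u * v) ∈ I) (n : ℕ) (hn : X ^ n ∈ I) : I = ⊤ := by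
  induction n with
  | zero =>
    refine Submodule.eq_top_iff'.mpr fun w => ?_
    obtain ⟨v, rfl⟩ := derivative_surjective F w
    simpa using hI _ hn v
  | succ n ih =>
    have h := hI _ hn 1
    rw [mul_one, derivative_X_pow_succ] at h
    exact ih ((I.smul_mem_iff (Nat.cast_add_one_ne_zero n)).mp h)

theorem exists_mul_eq_X_pow {F : Type*} [Field F] {u : PowerSeries F} (hu : u ≠ 0) :
    ∃ (v : PowerSeries F) (n : ℕ), u * v = X ^ n :=
  ⟨Inv_divided_by_X_pow_order hu, u.order.toNat, by
    have h := congrArg (X ^ u.order.toNat * ·) (Inv_divided_by_X_pow_order_rightInv hu)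
    simpa only [← mul_assoc, X_pow_order_mul_divXPowOrder, mul_one] using h⟩

end PowerSeries

/-- Let `F` be a field of characteristic 0.  The *Beltrami algebra*, namely
the formal power series ring `F[[x]]` equipped with the commutative bilinear product
`f ∘ g = (f·g)'` (the formal derivative of the product `f·g`), is a simple algebra:
its product is not identically zero and its only ideals are `0` and `F[[x]]`. -/
theorem beltrami_algebra_is_simple (F : Type) [Field F] [CharZero F] :
    (∃ f g : PowerSeries F, PowerSeries.derivative F (f * g) ≠ 0) ∧
    (∀ I : Submodule F (PowerSeries F),
      (∀ u ∈ I, ∀ v : PowerSeries F,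
        PowerSeries.derivative F (u * v) ∈ I ∧ PowerSeries.derivative F (v * u) ∈ I) →
      I = ⊥ ∨ I = ⊤) := by
  refine ⟨⟨PowerSeries.X, 1, ?_⟩, fun I hI => ?_⟩
  · simp
  · refine (eq_or_ne I ⊥).imp_right fun hne => ?_
    obtain ⟨u, hu, hu0⟩ := I.exists_mem_ne_zero_of_ne_bot hne
    obtain ⟨v, n, hv⟩ := PowerSeries.exists_mul_eq_X_pow hu0
    have h := (hI u hu (v * PowerSeries.X)).1
    rw [← mul_assoc, hv, ← pow_succ, PowerSeries.derivative_X_pow_succ] at h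
    exact PowerSeries.eq_top_of_X_pow_mem (fun u hu v => (hI u hu v).1) n
      ((I.smul_mem_iff (Nat.cast_add_one_ne_zero n)).mp h)
end

section
/- Let F be an algebraically closed field of characteristic 0. On J = F[[x]] ⊕ F[[x]] ⊕ F[[x]] define the anti-commutative bilinear product (f₁, g₁, h₁) • (f₂, g₂, h₂) = (f₁f₂' − f₂f₁' + g₁h₂ − g₂h₁, f₁g₂' − f₂g₁', f₁h₂' − f₂h₁') (this is the algebra LS_{1,3}, with fd/dx • gd/dx = [fd/dx, gd/dx], fd/dx • g = fg', fd/dx • g̃ = (fg')~, f • g̃ = fg d/dx, f • g = 0, f̃ • g̃ = 0). Then LS_{1,3} is a simple anti-commutative algebra: its only closed ideals are 0 and J. -/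
noncomputable section

variable (F : Type) [Field F]

/-- The formal derivative on `F[[x]]`, as a linear map. -/
def dP : PowerSeries F →ₗ[F] PowerSeries F :=
  (PowerSeries.derivative F).toLinearMap

/-- `(u, v) ↦ A u * B v` for linear maps `A B : J →ₗ F[[x]]`. -/
def tmul {J : Type} [AddCommGroup J] [Module F J]
    (A B : J →ₗ[F] PowerSeries F) : J →ₗ[F] J →ₗ[F] PowerSeries F :=
  (LinearMap.mul F (PowerSeries F)).compl₁₂ A B

/-- The product of `LS₁,₃` on `J = F[[x]]·(d/dx) ⊕ F[[x]] ⊕ F[[x]]~`, encoded as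
`F[[x]] × (F[[x]] × F[[x]])`:
`(f₁, g₁, h₁) • (f₂, g₂, h₂) = (f₁f₂' − f₂f₁' + g₁h₂ − g₂h₁, f₁g₂' − f₂g₁',
f₁h₂' − f₂h₁')`. -/
def lsProduct :
    (PowerSeries F × PowerSeries F × PowerSeries F) →ₗ[F]
      (PowerSeries F × PowerSeries F × PowerSeries F) →ₗ[F]
        (PowerSeries F × PowerSeries F × PowerSeries F) :=
  letI P := PowerSeries F
  letI p₁ : (P × P × P) →ₗ[F] P := LinearMap.fst F P (P × P)
  letI p₂ : (P × P × P) →ₗ[F] P := (LinearMap.fst F P P) ∘ₗ (LinearMap.snd F P (P × P))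
  letI p₃ : (P × P × P) →ₗ[F] P := (LinearMap.snd F P P) ∘ₗ (LinearMap.snd F P (P × P))
  letI c₁ : (P × P × P) →ₗ[F] (P × P × P) →ₗ[F] P :=
    (tmul F p₁ ((dP F) ∘ₗ p₁) - (tmul F p₁ ((dP F) ∘ₗ p₁)).flip) +
      (tmul F p₂ p₃ - (tmul F p₂ p₃).flip)
  letI c₂ : (P × P × P) →ₗ[F] (P × P × P) →ₗ[F] P :=
    tmul F p₁ ((dP F) ∘ₗ p₂) - (tmul F p₁ ((dP F) ∘ₗ p₂)).flip
  letI c₃ : (P × P × P) →ₗ[F] (P × P × P) →ₗ[F] P :=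
    tmul F p₁ ((dP F) ∘ₗ p₃) - (tmul F p₁ ((dP F) ∘ₗ p₃)).flip
  c₁.compr₂ (LinearMap.inl F P (P × P)) +
    (c₂.compr₂ (LinearMap.inl F P P) + c₃.compr₂ (LinearMap.inr F P P)).compr₂
      (LinearMap.inr F P (P × P))

open PowerSeries in
theorem lsProduct_apply (F : Type) [Field F] (f₁ g₁ h₁ f₂ g₂ h₂ : PowerSeries F) :
    lsProduct F (f₁, g₁, h₁) (f₂, g₂, h₂) =
      (f₁ * d⁄dX F f₂ - f₂ * d⁄dX F f₁ + (g₁ * h₂ - g₂ * h₁),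
        f₁ * d⁄dX F g₂ - f₂ * d⁄dX F g₁, f₁ * d⁄dX F h₂ - f₂ * d⁄dX F h₁) := by
  simp [lsProduct, tmul, dP]

/-- In characteristic zero, an `F`-subspace of `F[[x]]` that is stable under the derivation and
contains all multiples of a nonzero power series is everything. -/
theorem PowerSeries.mem_of_forall_mul_mem {F : Type} [Field F] [CharZero F]
    {K : Submodule F (PowerSeries F)} (hK : ∀ p ∈ K, PowerSeries.derivative F p ∈ K)
    {g : PowerSeries F} (hg : g ≠ 0) (hgK : ∀ k, g * k ∈ K) (k : PowerSeries F) : k ∈ K := by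
  obtain ⟨n, hn⟩ : ∃ n, PowerSeries.coeff n g ≠ 0 := by
    by_contra! h
    exact hg (PowerSeries.ext (by simpa using h))
  clear hg
  induction n generalizing g with
  | zero =>
    have := hgK (g⁻¹ * k)
    rwa [← mul_assoc, PowerSeries.mul_inv_cancel g (by simpa using hn), one_mul] at this
  | succ n ih =>
    refine ih (g := PowerSeries.derivative F g) (fun k => ?_) ?_
    · have := K.sub_mem (hK _ (hgK k)) (hgK (PowerSeries.derivative F k))
      rw [Derivation.leibniz] at this
      simpa [mul_comm] using this
    · rw [PowerSeries.coeff_derivative]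
      exact mul_ne_zero hn (by exact_mod_cast n.succ_ne_zero)

/-- A subspace stable under right multiplication in `LS₁,₃` and containing an element with nonzero
second component is everything. -/
theorem lsProduct_eq_top_of_snd_ne_zero {F : Type} [Field F] [CharZero F]
    {I : Submodule F (PowerSeries F × PowerSeries F × PowerSeries F)}
    (hI : ∀ u ∈ I, ∀ v, lsProduct F u v ∈ I) {f g h : PowerSeries F}
    (hu : (f, g, h) ∈ I) (hg : g ≠ 0) : I = ⊤ := by
  have third (k : PowerSeries F) : (0, 0, k) ∈ I := by
    let K : Submodule F (PowerSeries F) :=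
      I.comap (LinearMap.inr F _ _ ∘ₗ LinearMap.inr F (PowerSeries F) (PowerSeries F))
    refine PowerSeries.mem_of_forall_mul_mem (K := K) (fun p hp => ?_) hg (fun k => ?_) k
    · have hp' : ((0 : PowerSeries F), (0 : PowerSeries F), p) ∈ I := hp
      have := I.neg_mem (hI _ hp' (1, 0, 0))
      simpa [K, lsProduct_apply] using this
    · have := hI _ (hI _ hu (0, 0, k)) (0, 0, PowerSeries.X)
      simpa [K, lsProduct_apply] using this
  have first (k : PowerSeries F) : (k, 0, 0) ∈ I := by
    simpa [lsProduct_apply] using I.neg_mem (hI _ (third k) (0, 1, 0))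
  have second (k : PowerSeries F) : (0, k, 0) ∈ I := by
    simpa [lsProduct_apply] using hI _ (first k) (0, PowerSeries.X, 0)
  refine eq_top_iff.2 fun ⟨a, b, c⟩ _ => ?_
  simpa using I.add_mem (I.add_mem (first a) (second b)) (third c)

/-- Let `F` be an algebraically closed field of characteristic 0.  The
anti-commutative algebra `LS₁,₃` on `J = F[[x]] ⊕ F[[x]] ⊕ F[[x]]` with product
`(f₁, g₁, h₁) • (f₂, g₂, h₂) = (f₁f₂' − f₂f₁' + g₁h₂ − g₂h₁, f₁g₂' − f₂g₁', f₁h₂' − f₂h₁')`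
is simple: its product is not identically zero and its only closed ideals are `0` and `J`. -/
theorem LS13_simple (F : Type) [Field F] [CharZero F] [IsAlgClosed F] :
    letI : TopologicalSpace F := ⊥
    letI : TopologicalSpace (PowerSeries F) := Pi.topologicalSpace
    lsProduct F ≠ 0 ∧
    (∀ I : Submodule F (PowerSeries F × PowerSeries F × PowerSeries F),
      IsClosed (I : Set (PowerSeries F × PowerSeries F × PowerSeries F)) →
      (∀ u ∈ I, ∀ v, lsProduct F u v ∈ I ∧ lsProduct F v u ∈ I) →
      I = ⊥ ∨ I = ⊤) := by
  refine ⟨fun h => ?_, fun I _ hI => ?_⟩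
  · have := congrArg Prod.fst (congrArg (fun B => B (1, 0, 0) (PowerSeries.X, 0, 0)) h)
    simp [lsProduct_apply] at this
  · have hR : ∀ u ∈ I, ∀ v, lsProduct F u v ∈ I := fun u hu v => (hI u hu v).1
    have of_fst_ne_zero {f g h : PowerSeries F} (hu : (f, g, h) ∈ I) (hf : f ≠ 0) : I = ⊤ := by
      have := hR _ hu (0, PowerSeries.X, 0)
      rw [lsProduct_apply] at this
      exact lsProduct_eq_top_of_snd_ne_zero hR this (by simpa using hf)
    refine or_iff_not_imp_left.2 fun hne => ?_
    obtain ⟨⟨f, g, h⟩, hu, hu0⟩ := I.ne_bot_iff.1 hne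
    by_cases hf : f = 0
    · by_cases hg : g = 0
      · have hh : h ≠ 0 := by
          rintro rfl
          exact hu0 (by simp [hf, hg])
        have := hR _ hu (0, 1, 0)
        rw [lsProduct_apply] at this
        exact of_fst_ne_zero this (by simpa using hh)
      · exact lsProduct_eq_top_of_snd_ne_zero hR hu hg
    · exact of_fst_ne_zero hu hf

end
end
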